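/- arXiv:1701.03903 — 2 statements merged into one kernel-verified Lean document; each statement's English description precedes it below -/
import Mathlib

section
/- For every $m,n,k\in\mathbb{N}$ and $R>0$, there exist a $k$-disjoint uniformly bounded family $\mathcal{U}_0$ and $R$-disjoint uniformly bounded families $\mathcal{U}_1,\dots,\mathcal{U}_{m2^m}$ of subsets of $\mathbb{Z}^m\times(k\mathbb{Z})^n$ (with the maximum metric) such that $\bigcup_{i=0}^{m2^m}\mathcal{U}_i$ covers $\mathbb{Z}^m\times(k\mathbb{Z})^n$. -/
noncomputable section
open Metric Set
open scoped ENNReal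

/-- A family of subsets is `R`-bounded if every member has diameter at most `R`. -/
def RBounded {X : Type*} [PseudoMetricSpace X] (R : ℝ) (U : Set (Set X)) : Prop :=
  ∀ A ∈ U, ∀ x ∈ A, ∀ y ∈ A, dist x y ≤ R

/-- A family of subsets is `r`-disjoint if distinct members are at distance at least `r`. -/
def RDisjoint {X : Type*} [PseudoMetricSpace X] (r : ℝ) (U : Set (Set X)) : Prop :=
  ∀ A ∈ U, ∀ B ∈ U, A ≠ B → ∀ x ∈ A, ∀ y ∈ B, r ≤ dist x y

/-- A family of subsets is uniformly bounded if it is `R`-bounded for some `R`. -/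
def UniformlyBounded {X : Type*} [PseudoMetricSpace X] (U : Set (Set X)) : Prop :=
  ∃ R : ℝ, RBounded R U

/-- The family of level sets of `f` on the set where `P` holds. -/
def levelFam {X ι : Type*} (P : X → Prop) (f : X → ι) : Set (Set X) :=
  {A | ∃ a, A = {x | P x ∧ f x = a}}

lemma levelFam_disjoint {X ι : Type*} [PseudoMetricSpace X] (P : X → Prop) (f : X → ι) (r : ℝ)
    (h : ∀ x y, P x → P y → f x ≠ f y → r ≤ dist x y) : RDisjoint r (levelFam P f) := by
  rintro A ⟨a, rfl⟩ B ⟨b, rfl⟩ hAB x ⟨hx, hxa⟩ y ⟨hy, hyb⟩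
  apply h x y hx hy
  intro hxy
  apply hAB
  rw [← hxa, ← hyb, hxy]

lemma levelFam_bounded {X ι : Type*} [PseudoMetricSpace X] (P : X → Prop) (f : X → ι) (C : ℝ)
    (h : ∀ x y, f x = f y → dist x y ≤ C) : UniformlyBounded (levelFam P f) := by
  refine ⟨C, ?_⟩
  rintro A ⟨a, rfl⟩ x ⟨_, hxa⟩ y ⟨_, hyb⟩
  exact h x y (hxa.trans hyb.symm)

section helpers
variable {m n k : ℕ}

lemma le_dist_fst (p q : (Fin m → ℤ) × {y : Fin n → ℤ // ∀ i, (k : ℤ) ∣ y i}) (j : Fin m) (r : ℤ)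
    (h : r ≤ |p.1 j - q.1 j|) : (r : ℝ) ≤ dist p q := by
  have h1 : dist (p.1 j) (q.1 j) ≤ dist p.1 q.1 := dist_le_pi_dist p.1 q.1 j
  have h2 : dist p.1 q.1 ≤ dist p q := by rw [Prod.dist_eq]; exact le_max_left _ _
  refine le_trans ?_ (h1.trans h2)
  rw [Int.dist_eq]
  exact_mod_cast h

lemma le_dist_snd (p q : (Fin m → ℤ) × {y : Fin n → ℤ // ∀ i, (k : ℤ) ∣ y i}) (j : Fin n) (r : ℤ)
    (h : r ≤ |p.2.1 j - q.2.1 j|) : (r : ℝ) ≤ dist p q := by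
  have h1 : dist (p.2.1 j) (q.2.1 j) ≤ dist p.2.1 q.2.1 := dist_le_pi_dist p.2.1 q.2.1 j
  have h2 : dist p.2.1 q.2.1 ≤ dist p q := by
    rw [Prod.dist_eq]; exact le_max_right _ _
  refine le_trans ?_ (h1.trans h2)
  rw [Int.dist_eq]
  exact_mod_cast h

lemma dist_le_of_coord (p q : (Fin m → ℤ) × {y : Fin n → ℤ // ∀ i, (k : ℤ) ∣ y i}) (r : ℤ)
    (hr : 0 ≤ r) (h2 : p.2 = q.2) (h : ∀ j, |p.1 j - q.1 j| ≤ r) : dist p q ≤ (r : ℝ) := by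
  have hr' : (0 : ℝ) ≤ r := by exact_mod_cast hr
  rw [Prod.dist_eq, h2, dist_self]
  refine max_le ((dist_pi_le_iff hr').2 fun j => ?_) hr'
  rw [Int.dist_eq]
  exact_mod_cast h j

end helpers

lemma abs_sub_le_of_ediv_eq (M a b : ℤ) (hM : 0 < M) (h : a / M = b / M) : |a - b| ≤ M := by
  have h1 := Int.mul_ediv_add_emod a M
  have h2 := Int.mul_ediv_add_emod b M
  have h3 := Int.emod_nonneg a hM.ne'
  have h4 := Int.emod_nonneg b hM.ne'
  have h5 := Int.emod_lt_of_pos a hM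
  have h6 := Int.emod_lt_of_pos b hM
  rw [h] at h1
  rw [abs_le]
  constructor <;> linarith

lemma le_abs_of_dvd (d a b : ℤ) (h : d ∣ a - b) (hab : a ≠ b) : d ≤ |a - b| :=
  Int.le_of_dvd (abs_pos.2 (sub_ne_zero.2 hab)) ((dvd_abs _ _).2 h)

lemma sep_parity (M a b : ℤ) (hM : 0 < M) (h : a / M ≠ b / M) (hp : (a / M) % 2 = (b / M) % 2) :
    M ≤ |a - b| := by
  have h1 := Int.mul_ediv_add_emod a M
  have h2 := Int.mul_ediv_add_emod b M
  have h3 := Int.emod_nonneg a hM.ne'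
  have h4 := Int.emod_nonneg b hM.ne'
  have h5 := Int.emod_lt_of_pos a hM
  have h6 := Int.emod_lt_of_pos b hM
  rw [le_abs]
  rcases lt_or_gt_of_ne h with h' | h'
  · right
    have : a / M + 2 ≤ b / M := by omega
    nlinarith
  · left
    have : b / M + 2 ≤ a / M := by omega
    nlinarith

lemma sep_block (L K a b : ℤ) (hL : 0 < L) (h : a / L ≠ b / L) (ha : K ≤ a % L) (hb : K ≤ b % L) :
    K ≤ |a - b| := by
  have h1 := Int.mul_ediv_add_emod a L
  have h2 := Int.mul_ediv_add_emod b L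
  have h5 := Int.emod_lt_of_pos a hL
  have h6 := Int.emod_lt_of_pos b hL
  rw [le_abs]
  rcases lt_or_gt_of_ne h with h' | h'
  · right
    have : a / L + 1 ≤ b / L := by omega
    nlinarith
  · left
    have : b / L + 1 ≤ a / L := by omega
    nlinarith

lemma sep_gap (S N K M c c' a b : ℤ) (hM : 0 < M) (hK : 0 ≤ K) (hS : S = M + K) (hN : 0 < N)
    (hc : 0 ≤ c) (hcN : c < N)
    (hc' : 0 ≤ c') (hcN' : c' < N) (hcc : c ≠ c') (ha : (a - c * S) % (N * S) < K)
    (hb : (b - c' * S) % (N * S) < K) : M ≤ |a - b| := by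
  have hS0 : 0 < S := by omega
  have hL : 0 < N * S := by positivity
  have h1 := Int.mul_ediv_add_emod (a - c * S) (N * S)
  have h2 := Int.mul_ediv_add_emod (b - c' * S) (N * S)
  have h3 := Int.emod_nonneg (a - c * S) hL.ne'
  have h4 := Int.emod_nonneg (b - c' * S) hL.ne'
  set u := (a - c * S) / (N * S)
  set v := (b - c' * S) / (N * S)
  set r := (a - c * S) % (N * S)
  set s := (b - c' * S) % (N * S)
  have key : a - b = S * ((c - c') + N * (u - v)) + (r - s) := by linear_combination h2 - h1
  have hne : (c - c') + N * (u - v) ≠ 0 := by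
    intro h0
    have hd : N ∣ c - c' := ⟨v - u, by linear_combination h0⟩
    have := le_abs_of_dvd N c c' hd hcc
    rw [le_abs] at this
    omega
  rw [key, le_abs]
  rcases lt_or_gt_of_ne hne with h' | h'
  · right
    have : (c - c') + N * (u - v) ≤ -1 := by omega
    nlinarith
  · left
    have : 1 ≤ (c - c') + N * (u - v) := by omega
    nlinarith

/-- Lemma 4.2: `ℤ^m × (kℤ)^n` can be covered by a `k`-disjoint uniformly bounded family
together with `m·2^m` many `R`-disjoint uniformly bounded families. -/
theorem cover_Zm_times_kZn (m n k : ℕ) (R : ℝ) (hR : 0 < R) :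
    ∃ U : Fin (m * 2 ^ m + 1) →
        Set (Set ((Fin m → ℤ) × {y : Fin n → ℤ // ∀ i, (k : ℤ) ∣ y i})),
      (∀ i, UniformlyBounded (U i)) ∧ RDisjoint (k : ℝ) (U 0) ∧
      (∀ i, i ≠ 0 → RDisjoint R (U i)) ∧
      (Set.univ : Set ((Fin m → ℤ) × {y : Fin n → ℤ // ∀ i, (k : ℤ) ∣ y i})) ⊆
        ⋃ i, ⋃₀ U i := by
  obtain ⟨M, hRM⟩ := exists_nat_ge R
  have hM : 0 < M := by
    rcases Nat.eq_zero_or_pos M with h | h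
    · subst h; simp at hRM; linarith
    · exact h
  haveI : NeZero M := ⟨hM.ne'⟩
  have hMz : (0 : ℤ) < M := by exact_mod_cast hM
  let N : ℕ := Fintype.card (Fin n → ZMod M)
  have hN : (0 : ℤ) < N := by exact_mod_cast (Fintype.card_pos : 0 < Fintype.card (Fin n → ZMod M))
  let c : {y : Fin n → ℤ // ∀ i, (k : ℤ) ∣ y i} → Fin N := fun y =>
    Fintype.equivFin (Fin n → ZMod M) (fun i => ((y.1 i : ℤ) : ZMod M))
  have hc : ∀ y y', y ≠ y' → c y = c y' → ∃ i, (M : ℤ) ≤ |y.1 i - y'.1 i| := by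
    intro y y' hne h
    have h1 := (Fintype.equivFin (Fin n → ZMod M)).injective h
    have h2 : ∃ i, y.1 i ≠ y'.1 i := by
      by_contra! hcon
      exact hne (Subtype.ext (funext hcon))
    obtain ⟨i, hi⟩ := h2
    refine ⟨i, le_abs_of_dvd _ _ _ ?_ hi⟩
    have h3 := (ZMod.intCast_eq_intCast_iff_dvd_sub _ _ _).1 (congrFun h1 i)
    exact (dvd_sub_comm).1 h3
  let S : ℤ := M + k
  have hS : 0 < S := by positivity
  have hL : 0 < (N : ℤ) * S := by positivity
  let e : Fin (m * 2 ^ m) ≃ Fin m × (Fin m → Fin 2) :=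
    (Fintype.equivFinOfCardEq (by simp)).symm
  let U0 : Set (Set ((Fin m → ℤ) × {y : Fin n → ℤ // ∀ i, (k : ℤ) ∣ y i})) :=
    levelFam (fun p => ∀ j, (k : ℤ) ≤ (p.1 j - ((c p.2 : ℕ) : ℤ) * S) % (N * S))
      (fun p => (p.2, fun j => (p.1 j - ((c p.2 : ℕ) : ℤ) * S) / (N * S)))
  let V : Fin m × (Fin m → Fin 2) →
      Set (Set ((Fin m → ℤ) × {y : Fin n → ℤ // ∀ i, (k : ℤ) ∣ y i})) := fun w =>
    levelFam (fun p => (p.1 w.1 - ((c p.2 : ℕ) : ℤ) * S) % (N * S) < k ∧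
        ∀ j, (p.1 j / (M : ℤ)) % 2 = ((w.2 j : ℕ) : ℤ))
      (fun p => (p.2, fun j => p.1 j / (M : ℤ)))
  refine ⟨Fin.cons U0 (fun t => V (e t)), ?_, ?_, ?_, ?_⟩
  · intro i
    refine Fin.cases ?_ (fun t => ?_) i
    · simp only [Fin.cons_zero]
      refine levelFam_bounded _ _ ((N * S : ℤ) : ℝ) fun p q h => ?_
      have h1 : p.2 = q.2 := congrArg Prod.fst h
      have h2 := congrArg Prod.snd h
      refine dist_le_of_coord p q _ hL.le h1 fun j => ?_
      have h3 := congrFun h2 j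
      simp only [h1] at h3
      simpa using abs_sub_le_of_ediv_eq _ _ _ hL h3
    · simp only [Fin.cons_succ]
      refine levelFam_bounded _ _ ((M : ℤ) : ℝ) fun p q h => ?_
      have h1 : p.2 = q.2 := congrArg Prod.fst h
      have h2 := congrArg Prod.snd h
      exact dist_le_of_coord p q _ hMz.le h1 fun j =>
        abs_sub_le_of_ediv_eq _ _ _ hMz (congrFun h2 j)
  · simp only [Fin.cons_zero]
    refine levelFam_disjoint _ _ _ fun p q hp hq h => ?_
    rw [← Int.cast_natCast]
    by_cases h1 : p.2 = q.2
    · have h2 : ∃ j, (p.1 j - ((c p.2 : ℕ) : ℤ) * S) / (N * S) ≠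
          (q.1 j - ((c q.2 : ℕ) : ℤ) * S) / (N * S) := by
        by_contra! hcon
        exact h (Prod.ext h1 (funext hcon))
      obtain ⟨j, hj⟩ := h2
      apply le_dist_fst p q j
      have := sep_block _ _ _ _ hL hj (hp j) (hq j)
      simpa [h1] using this
    · have h2 : ∃ i, p.2.1 i ≠ q.2.1 i := by
        by_contra! hcon
        exact h1 (Subtype.ext (funext hcon))
      obtain ⟨i, hi⟩ := h2
      exact le_dist_snd p q i _ (le_abs_of_dvd _ _ _ (dvd_sub (p.2.2 i) (q.2.2 i)) hi)
  · intro i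
    refine Fin.cases (fun h => (h rfl).elim) (fun t _ => ?_) i
    simp only [Fin.cons_succ]
    refine levelFam_disjoint _ _ _ fun p q hp hq h => hRM.trans ?_
    rw [← Int.cast_natCast]
    by_cases h1 : p.2 = q.2
    · have h2 : ∃ j, p.1 j / (M : ℤ) ≠ q.1 j / (M : ℤ) := by
        by_contra! hcon
        exact h (Prod.ext h1 (funext hcon))
      obtain ⟨j, hj⟩ := h2
      exact le_dist_fst p q j _ (sep_parity _ _ _ hMz hj ((hp.2 j).trans (hq.2 j).symm))
    · by_cases h2 : c p.2 = c q.2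
      · obtain ⟨i, hi⟩ := hc _ _ h1 h2
        exact le_dist_snd p q i _ hi
      · refine le_dist_fst p q (e t).1 _ (sep_gap S N k M (c p.2 : ℕ) (c q.2 : ℕ) _ _ hMz
          (by positivity) rfl hN (by positivity) (by exact_mod_cast (c p.2).2) (by positivity)
          (by exact_mod_cast (c q.2).2) ?_ hp.1 hq.1)
        intro h3
        exact h2 (Fin.ext (by exact_mod_cast h3))
  · intro p _
    rw [mem_iUnion]
    by_cases h : ∀ j, (k : ℤ) ≤ (p.1 j - ((c p.2 : ℕ) : ℤ) * S) % (N * S)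
    · refine ⟨0, ?_⟩
      simp only [Fin.cons_zero]
      exact ⟨_, ⟨_, rfl⟩, h, rfl⟩
    · push Not at h
      obtain ⟨i, hi⟩ := h
      let ε : Fin m → Fin 2 := fun j => ⟨((p.1 j / (M : ℤ)) % 2).toNat, by omega⟩
      refine ⟨Fin.succ (e.symm (i, ε)), ?_⟩
      simp only [Fin.cons_succ, Equiv.apply_symm_apply]
      refine ⟨_, ⟨_, rfl⟩, ⟨hi, fun j => ?_⟩, rfl⟩
      simp only [ε]
      omega
end
end

section
/- Let $X=\mathrm{sh}\bigcup\bigoplus_{i=1}^{\infty}i\mathbb{Z}$ be the shift union defined below. Then $\mathrm{trasdim}(X)\le\omega+1$. -/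
noncomputable section
open Metric Set
open scoped ENNReal

/-- `asdim X ≤ n`: for every `r > 0` there are `n+1` uniformly bounded, `r`-disjoint
families of subsets of `X` whose union covers `X`. -/
def AsdimLE (X : Type*) [PseudoMetricSpace X] (n : ℕ) : Prop :=
  ∀ r : ℝ, 0 < r → ∃ U : Fin (n + 1) → Set (Set X),
    (∀ i, UniformlyBounded (U i)) ∧ (∀ i, RDisjoint r (U i)) ∧
    (Set.univ : Set X) ⊆ ⋃ i, ⋃₀ U i

/-- `M^a` in Borst's notation. -/
def Mder (M : Set (Finset ℕ)) (a : ℕ) : Set (Finset ℕ) :=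
  {τ | insert a τ ∈ M ∧ a ∉ τ}

/-- `OrdLE α M` means `Ord M ≤ α` in Borst's sense: `Ord M = 0` iff `M = ∅`, and
`Ord M ≤ α` iff `Ord M^a < α` for every `a ∈ ℕ`. -/
def OrdLE (α : Ordinal) (M : Set (Finset ℕ)) : Prop :=
  M = ∅ ∨ ∀ a : ℕ, ∃ β : {β : Ordinal // β < α}, OrdLE β.1 (Mder M a)
termination_by α
decreasing_by exact β.2

/-- The collection `A(X,d)` of finite sets `σ ⊆ ℕ` for which there are no uniformly
bounded families `U i` (`i ∈ σ`), each `i`-disjoint, whose union covers `X`. -/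
def AColl (X : Type*) [PseudoMetricSpace X] : Set (Finset ℕ) :=
  {σ | σ.Nonempty ∧ ¬ ∃ U : ℕ → Set (Set X),
    (∀ i ∈ σ, UniformlyBounded (U i)) ∧ (∀ i ∈ σ, RDisjoint (i : ℝ) (U i)) ∧
    (Set.univ : Set X) ⊆ ⋃ i ∈ σ, ⋃₀ U i}

/-- A point of the shift union `sh⋃ ⊕_{i=1}^∞ iℤ`:  an element `((x_i)_{i∈ℤ}, j)` of
`(⊕_{i∈ℤ} ℤ) × ℤ` with `x_i = 0` for `i < j` and `x_i ∈ (i-j+1)ℤ` for `i ≥ j`. -/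
structure ShPt where
  base : ℤ
  coords : ℤ → ℤ
  coords_eq_zero : ∀ i, i < base → coords i = 0
  coords_dvd : ∀ i, base ≤ i → (i - base + 1) ∣ coords i
  finsupp : (Function.support coords).Finite

/-- The sequence in `ℓ¹` associated to a point (the extra `none` coordinate records
the second factor `ℤ`, so that the `ℓ¹` distance is `∑_i |x_i-y_i| + |a-b|`). -/
def ShPt.f (p : ShPt) : Option ℤ → ℝ :=
  fun o => o.elim (p.base : ℝ) fun i => (p.coords i : ℝ)

lemma ShPt.memlp (p : ShPt) : Memℓp p.f 1 := by
  apply memℓp_gen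
  apply summable_of_finite_support
  apply Set.Finite.subset (Set.Finite.insert none (p.finsupp.image some))
  intro x hx
  rcases x with _ | i
  · exact Set.mem_insert _ _
  · right
    refine Set.mem_image_of_mem _ ?_
    intro h0
    apply hx
    simp [ShPt.f, h0]

def ShPt.F (p : ShPt) : lp (fun _ : Option ℤ => ℝ) 1 := ⟨p.f, p.memlp⟩

instance : PseudoMetricSpace ShPt := PseudoMetricSpace.induced ShPt.F inferInstance

theorem ordLE_nat (n : ℕ) : ∀ M : Set (Finset ℕ), (∀ σ ∈ M, σ.card < n) → OrdLE (n : Ordinal) M := by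
  induction n with
  | zero =>
    intro M h
    rw [OrdLE]
    left
    ext σ
    simp only [Set.mem_empty_iff_false, iff_false]
    intro hσ
    exact absurd (h σ hσ) (Nat.not_lt_zero _)
  | succ n ih =>
    intro M h
    rw [OrdLE]
    right
    intro a
    refine ⟨⟨(n : Ordinal), by exact_mod_cast Nat.lt_succ_self n⟩, ih _ ?_⟩
    rintro τ ⟨h1, h2⟩
    have := h _ h1
    rw [Finset.card_insert_of_notMem h2] at this
    omega

theorem ShPt.dist_eq (x y : ShPt) (F : Finset ℤ) (hx : ∀ i, i ∉ F → x.coords i = 0)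
    (hy : ∀ i, i ∉ F → y.coords i = 0) :
    dist x y = ((|x.base - y.base| + ∑ i ∈ F, |x.coords i - y.coords i| : ℤ) : ℝ) := by
  have h1 : dist x y = ‖x.F - y.F‖ := by
    rw [← dist_eq_norm]; rfl
  rw [h1, lp.norm_eq_tsum_rpow (by norm_num)]
  simp only [ENNReal.toReal_one, Real.rpow_one, div_one]
  rw [tsum_eq_sum (s := Finset.insertNone F)]
  · rw [Finset.sum_insertNone]
    push_cast
    rfl
  · intro o ho
    rcases o with _ | i
    · simp at ho
    · have hi : i ∉ F := by simpa using ho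
      have : (x.F - y.F) (some i) = (x.coords i : ℝ) - (y.coords i : ℝ) := rfl
      rw [this, hx i hi, hy i hi]
      simp

def ShPt.dz (x y : ShPt) : ℤ :=
  |x.base - y.base| + ∑ i ∈ (x.finsupp.toFinset ∪ y.finsupp.toFinset), |x.coords i - y.coords i|

theorem ShPt.dist_dz (x y : ShPt) : dist x y = (ShPt.dz x y : ℝ) := by
  apply ShPt.dist_eq
  · intro i hi
    by_contra h
    exact hi (by simp [h])
  · intro i hi
    by_contra h
    exact hi (by simp [h])

theorem ShPt.dz_eq (x y : ShPt) (F : Finset ℤ) (hx : ∀ i, i ∉ F → x.coords i = 0)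
    (hy : ∀ i, i ∉ F → y.coords i = 0) :
    ShPt.dz x y = |x.base - y.base| + ∑ i ∈ F, |x.coords i - y.coords i| := by
  have := ShPt.dist_eq x y F hx hy
  rw [ShPt.dist_dz] at this
  exact_mod_cast this

theorem ShPt.dz_symm (x y : ShPt) : ShPt.dz x y = ShPt.dz y x := by
  have := dist_comm x y
  rw [ShPt.dist_dz, ShPt.dist_dz] at this
  exact_mod_cast this

theorem ShPt.dz_tri (x y z : ShPt) : ShPt.dz x z ≤ ShPt.dz x y + ShPt.dz y z := by
  have := dist_triangle x y z
  rw [ShPt.dist_dz, ShPt.dist_dz, ShPt.dist_dz] at this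
  exact_mod_cast this

theorem ShPt.dz_self (x : ShPt) : ShPt.dz x x = 0 := by
  have := dist_self x
  rw [ShPt.dist_dz] at this
  exact_mod_cast this

theorem ShPt.exF (x y : ShPt) : ∃ F : Finset ℤ, (∀ i, i ∉ F → x.coords i = 0) ∧
    (∀ i, i ∉ F → y.coords i = 0) := by
  refine ⟨x.finsupp.toFinset ∪ y.finsupp.toFinset, ?_, ?_⟩
  · intro i hi
    by_contra h
    exact hi (by simp [h])
  · intro i hi
    by_contra h
    exact hi (by simp [h])

theorem ShPt.base_le (x y : ShPt) : |x.base - y.base| ≤ ShPt.dz x y := by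
  unfold ShPt.dz
  have := Finset.sum_nonneg (s := (x.finsupp.toFinset ∪ y.finsupp.toFinset))
    (f := fun i => |x.coords i - y.coords i|) (fun i _ => abs_nonneg _)
  linarith

theorem ShPt.dz_nonneg (x y : ShPt) : 0 ≤ ShPt.dz x y :=
  le_trans (abs_nonneg _) (ShPt.base_le x y)

theorem ShPt.coord_le (x y : ShPt) (i : ℤ) : |x.coords i - y.coords i| ≤ ShPt.dz x y := by
  obtain ⟨F, hx, hy⟩ := ShPt.exF x y
  rw [ShPt.dz_eq x y (insert i F) (fun j hj => hx j (fun h => hj (by simp [h])))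
    (fun j hj => hy j (fun h => hj (by simp [h])))]
  have := Finset.single_le_sum (f := fun i => |x.coords i - y.coords i|)
    (fun i _ => abs_nonneg _) (Finset.mem_insert_self i F)
  have h2 := abs_nonneg (x.base - y.base)
  linarith

/-- Truncation to the coordinates with index at least `A`. -/
def ShPt.trunc (A : ℤ) (x : ShPt) : ShPt where
  base := x.base
  coords := fun i => if i < A then 0 else x.coords i
  coords_eq_zero := by
    intro i hi
    simp [x.coords_eq_zero i hi]
  coords_dvd := by
    intro i hi
    split_ifs
    · exact dvd_zero _
    · exact x.coords_dvd i hi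
  finsupp := by
    refine x.finsupp.subset ?_
    intro i hi
    simp only [Function.mem_support, ne_eq, ite_eq_left_iff, Classical.not_imp] at hi
    exact hi.2

theorem ShPt.trunc_le (A : ℤ) (x y : ShPt) :
    ShPt.dz (x.trunc A) (y.trunc A) ≤ ShPt.dz x y := by
  obtain ⟨F, hx, hy⟩ := ShPt.exF x y
  rw [ShPt.dz_eq x y F hx hy, ShPt.dz_eq (x.trunc A) (y.trunc A) F
    (fun j hj => by simp [ShPt.trunc, hx j hj]) (fun j hj => by simp [ShPt.trunc, hy j hj])]
  refine add_le_add le_rfl (Finset.sum_le_sum ?_)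
  intro i _
  simp only [ShPt.trunc]
  split_ifs
  · simp
  · exact le_rfl

theorem ShPt.le_trunc (a : ℤ) (n : ℕ) (C : ℤ) (x y : ShPt) (hx : ∀ i, i < a → x.coords i = 0)
    (hy : ∀ i, i < a → y.coords i = 0)
    (hC : ∀ i, a ≤ i → i < a + n → |x.coords i - y.coords i| ≤ C) :
    ShPt.dz x y ≤ ShPt.dz (x.trunc (a + n)) (y.trunc (a + n)) + n * C := by
  obtain ⟨F, hx', hy'⟩ := ShPt.exF x y
  have hxG : ∀ i, i ∉ F ∪ Finset.Ico a (a+n) → x.coords i = 0 :=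
    fun i hi => hx' i (fun h => hi (by simp [h]))
  have hyG : ∀ i, i ∉ F ∪ Finset.Ico a (a+n) → y.coords i = 0 :=
    fun i hi => hy' i (fun h => hi (by simp [h]))
  rw [ShPt.dz_eq x y _ hxG hyG, ShPt.dz_eq (x.trunc (a + n)) (y.trunc (a + n)) _
    (fun j hj => by simp [ShPt.trunc, hxG j hj]) (fun j hj => by simp [ShPt.trunc, hyG j hj])]
  have hs : (n : ℤ) * C = ∑ i ∈ Finset.Ico a (a+n), C := by simp
  have hs2 : ∑ i ∈ Finset.Ico a (a+n), C
      = ∑ i ∈ F ∪ Finset.Ico a (a+n), if i ∈ Finset.Ico a (a+n) then C else 0 := by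
    rw [← Finset.sum_filter]
    congr 1
    ext i
    simp only [Finset.mem_filter, Finset.mem_union]
    tauto
  rw [hs, hs2, add_assoc, ← Finset.sum_add_distrib]
  refine add_le_add le_rfl (Finset.sum_le_sum ?_)
  intro i _
  simp only [ShPt.trunc, Finset.mem_Ico]
  by_cases h1 : i < a
  · rw [hx i h1, hy i h1]
    rw [if_pos (by omega), if_neg (by omega)]
    simp
  · by_cases h2 : i < a + n
    · rw [if_pos h2, if_pos h2, if_pos ⟨by omega, h2⟩]
      simpa using hC i (by omega) h2
    · rw [if_neg h2, if_neg h2, if_neg (by omega)]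
      simp

theorem ShPt.trunc_eq (A : ℤ) (M : ℤ) (hM : 0 ≤ M) (x y : ShPt) (hb : x.base = y.base)
    (hA : x.base + M ≤ A)
    (hd : ShPt.dz (x.trunc A) (y.trunc A) ≤ M) : ShPt.dz (x.trunc A) (y.trunc A) = 0 := by
  obtain ⟨F, hx, hy⟩ := ShPt.exF (x.trunc A) (y.trunc A)
  rw [ShPt.dz_eq _ _ F hx hy]
  have : (x.trunc A).base - (y.trunc A).base = 0 := by simp [ShPt.trunc, hb]
  rw [this]
  simp only [abs_zero, zero_add]
  apply Finset.sum_eq_zero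
  intro i _
  have h := le_trans (ShPt.coord_le (x.trunc A) (y.trunc A) i) hd
  simp only [ShPt.trunc] at h ⊢
  split_ifs with hi
  · simp
  · rw [if_neg hi, if_neg hi] at h
    have d1 := x.coords_dvd i (by omega)
    have d2 := y.coords_dvd i (by omega)
    rw [← hb] at d2
    have d3 := dvd_sub d1 d2
    rw [abs_eq_zero]
    apply Int.eq_zero_of_abs_lt_dvd d3
    omega

/-- One step in a chain. -/
def Stp (S : Set ShPt) (r : ℤ) (x y : ShPt) : Prop := x ∈ S ∧ y ∈ S ∧ ShPt.dz x y < r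

def Comps (S : Set ShPt) (r : ℤ) : Set (Set ShPt) :=
  {A | ∃ x ∈ S, A = {y | Relation.ReflTransGen (Stp S r) x y}}

theorem stp_symm (S : Set ShPt) (r : ℤ) (x y : ShPt) (h : Stp S r x y) : Stp S r y x :=
  ⟨h.2.1, h.1, by rw [ShPt.dz_symm]; exact h.2.2⟩

theorem chain_symm (S : Set ShPt) (r : ℤ) (x y : ShPt) (h : Relation.ReflTransGen (Stp S r) x y) :
    Relation.ReflTransGen (Stp S r) y x :=
  haveI : Std.Symm (Stp S r) := ⟨fun x y h => stp_symm S r x y h⟩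
  Std.Symm.symm _ _ h

theorem chain_mem (S : Set ShPt) (r : ℤ) (x y : ShPt) (hx : x ∈ S)
    (h : Relation.ReflTransGen (Stp S r) x y) : y ∈ S := by
  induction h with
  | refl => exact hx
  | tail _ h _ => exact h.2.1

theorem comps_disj (S : Set ShPt) (r : ℤ) (i : ℝ) (hi : i ≤ r) : RDisjoint i (Comps S r) := by
  rintro A ⟨x, hx, rfl⟩ B ⟨y, hy, rfl⟩ hne u hu v hv
  by_contra hlt
  apply hne
  have huv : Relation.ReflTransGen (Stp S r) u v := by
    apply Relation.ReflTransGen.single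
    refine ⟨chain_mem S r x u hx hu, chain_mem S r y v hy hv, ?_⟩
    rw [ShPt.dist_dz] at hlt
    have : (ShPt.dz u v : ℝ) < r := by linarith
    exact_mod_cast this
  have hxy : Relation.ReflTransGen (Stp S r) x y :=
    (Relation.ReflTransGen.trans hu huv).trans (chain_symm S r _ _ hv)
  ext z
  exact ⟨fun h => (chain_symm S r _ _ hxy).trans h, fun h => hxy.trans h⟩

theorem comps_bdd (S : Set ShPt) (r R : ℤ)
    (h : ∀ x ∈ S, ∀ y, Relation.ReflTransGen (Stp S r) x y → ShPt.dz x y ≤ R) :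
    UniformlyBounded (Comps S r) := by
  refine ⟨R, ?_⟩
  rintro A ⟨x, hx, rfl⟩ u hu v hv
  rw [ShPt.dist_dz]
  exact_mod_cast h u (chain_mem S r x u hx hu) v ((chain_symm S r _ _ hu).trans hv)

theorem comps_cover (S : Set ShPt) (r : ℤ) : S ⊆ ⋃₀ Comps S r :=
  fun x hx => ⟨_, ⟨x, hx, rfl⟩, Relation.ReflTransGen.refl⟩

theorem annulus (k L : ℕ) (hk : 1 ≤ k) (T : Set ShPt) (col : ShPt → ℕ) (hcol : ∀ y, col y < L)
    (h : ∀ u ∈ T, ∀ v ∈ T, col u = col v → ShPt.dz u v ≤ 2 * (L + 1) * k → ShPt.dz u v = 0)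
    (x : ShPt) (hx : x ∈ T) :
    ∃ s : ℕ, 1 ≤ s ∧ s ≤ L ∧ ∀ y ∈ T, ¬ ((s * k : ℤ) ≤ ShPt.dz x y ∧ ShPt.dz x y < (s + 1) * k) := by
  by_contra hcon
  push Not at hcon
  have key : ∀ s : ℕ, s ≤ L → ∃ y ∈ T, (s * k : ℤ) ≤ ShPt.dz x y ∧ ShPt.dz x y < (s + 1) * k := by
    intro s hs
    rcases Nat.eq_zero_or_pos s with h0 | h0
    · subst h0
      refine ⟨x, hx, ?_⟩
      rw [ShPt.dz_self]
      push_cast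
      constructor
      · simp
      · simp; omega
    · exact hcon s h0 hs
  haveI : Nonempty ShPt := ⟨x⟩
  choose! y hyT hy1 hy2 using key
  obtain ⟨s, hs, t, ht, hst, hc⟩ := Finset.exists_ne_map_eq_of_card_lt_of_maps_to
    (s := Finset.range (L + 1)) (t := Finset.range L) (by simp) (f := fun s => col (y s))
    (by intro s _; simpa using hcol (y s))
  wlog hlt : s < t generalizing s t
  · exact this t ht s hs hst.symm hc.symm (by omega)
  have hs' : s ≤ L := by simpa [Nat.lt_succ_iff] using hs
  have ht' : t ≤ L := by simpa [Nat.lt_succ_iff] using ht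
  have a1 := hy1 s hs'
  have a2 := hy2 s hs'
  have b1 := hy1 t ht'
  have b2 := hy2 t ht'
  have tr := ShPt.dz_tri (y s) x (y t)
  rw [ShPt.dz_symm (y s) x] at tr
  have c1 : ((s : ℤ) + 1) * k ≤ (L + 1) * k :=
    mul_le_mul_of_nonneg_right (by exact_mod_cast Nat.succ_le_succ hs') (by positivity)
  have c2 : ((t : ℤ) + 1) * k ≤ (L + 1) * k :=
    mul_le_mul_of_nonneg_right (by exact_mod_cast Nat.succ_le_succ ht') (by positivity)
  have c3 : ((s : ℤ) + 1) * k ≤ t * k :=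
    mul_le_mul_of_nonneg_right (by exact_mod_cast hlt) (by positivity)
  have h0 := h (y s) (hyT s hs') (y t) (hyT t ht') hc (by nlinarith)
  have tr2 := ShPt.dz_tri x (y s) (y t)
  linarith

theorem ar_same (N u v : ℤ) (hN : 0 < N) (h : u / N = v / N) : |u - v| ≤ N := by
  have h1 := Int.mul_ediv_add_emod u N
  have h2 := Int.mul_ediv_add_emod v N
  have h3 := Int.emod_nonneg u hN.ne'
  have h4 := Int.emod_nonneg v hN.ne'
  have h5 := Int.emod_lt_of_pos u hN
  have h6 := Int.emod_lt_of_pos v hN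
  rw [h] at h1
  rw [abs_le]
  constructor <;> linarith

theorem ar_lt (N u v : ℤ) (hN : 0 < N) (h : u / N < v / N) :
    u < N * (v / N) ∧ N * (v / N) ≤ v := by
  have h1 := Int.mul_ediv_add_emod u N
  have h2 := Int.mul_ediv_add_emod v N
  have h4 := Int.emod_nonneg v hN.ne'
  have h5 := Int.emod_lt_of_pos u hN
  constructor <;> nlinarith

theorem ar_wall (N u v e e' k : ℤ) (hN : 0 < N) (h1 : e ∣ u) (h2 : e' ∣ v) (h3 : e ∣ N)
    (h4 : e' ∣ N) (h5 : k ≤ e) (h6 : k ≤ e') (h : |u - v| < k) : u / N = v / N := by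
  by_contra hne
  wlog hlt : u / N < v / N generalizing u v e e'
  · exact this v u e' e h2 h1 h4 h3 h6 h5 (by rw [abs_sub_comm]; exact h) (fun h => hne h.symm)
      (lt_of_le_of_ne (not_lt.mp hlt) (fun h => hne h.symm))
  obtain ⟨a, b⟩ := ar_lt N u v hN hlt
  have hd : e ∣ N * (v / N) - u := dvd_sub (Dvd.dvd.mul_right h3 _) h1
  have := Int.le_of_dvd (by linarith) hd
  rw [abs_lt] at h
  linarith [h.1]

theorem ar_gap (P z z' k : ℤ) (hP : 0 < P) (h1 : ¬ z % P < k) (h2 : ¬ z' % P < k)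
    (h : |z - z'| < k) : z / P = z' / P := by
  by_contra hne
  wlog hlt : z / P < z' / P generalizing z z'
  · exact this z' z h2 h1 (by rw [abs_sub_comm]; exact h) (fun h => hne h.symm)
      (lt_of_le_of_ne (not_lt.mp hlt) (fun h => hne h.symm))
  obtain ⟨a, b⟩ := ar_lt P z z' hP hlt
  have h3 := Int.mul_ediv_add_emod z' P
  rw [abs_lt] at h
  linarith [h.1]

theorem ar_adj (N u v m : ℤ) (hN : 0 < N) (hm : m ≤ N) (h : |u - v| < m) :
    |u / N - v / N| ≤ 1 := by
  rw [abs_lt] at h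
  have h1 : u / N ≤ (v + 1 * N) / N := Int.ediv_le_ediv hN (by linarith)
  have h2 : v / N ≤ (u + 1 * N) / N := Int.ediv_le_ediv hN (by linarith)
  rw [Int.add_mul_ediv_right _ _ hN.ne'] at h1 h2
  rw [abs_le]
  constructor <;> linarith

theorem ar_par (c c' : ℤ) (h : |c - c'| ≤ 1) (h2 : (c : ZMod 2) = (c' : ZMod 2)) : c = c' := by
  rw [ZMod.intCast_eq_intCast_iff_dvd_sub] at h2
  rw [abs_le] at h
  push_cast at h2
  omega

theorem ar_core (W m k c c' r r' : ℤ) (hW : W = m + k) (hm : 0 ≤ m) (hr : 0 ≤ r) (hr' : 0 ≤ r')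
    (h1 : r < k) (h2 : r' < k) (h : |(W * c + r) - (W * c' + r')| < m) : c = c' := by
  by_contra hne
  wlog hlt : c < c' generalizing c c' r r'
  · exact this c' c r' r hr' hr h2 h1 (by rw [abs_sub_comm]; exact h) (fun h => hne h.symm)
      (lt_of_le_of_ne (not_lt.mp hlt) (fun h => hne h.symm))
  rw [abs_lt] at h
  have : W * (c + 1) ≤ W * c' := mul_le_mul_of_nonneg_left (by linarith) (by linarith)
  linarith [h.1]

theorem ar_rep (W B k u q : ℤ) (hP : 0 < W * B) (h : (u - W * (q + 1)) % (W * B) < k) :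
    ∃ f r : ℤ, 0 ≤ r ∧ r < k ∧ u = W * (q + 1 + B * f) + r := by
  refine ⟨(u - W * (q + 1)) / (W * B), (u - W * (q + 1)) % (W * B),
    Int.emod_nonneg _ hP.ne', h, ?_⟩
  have := Int.mul_ediv_add_emod (u - W * (q + 1)) (W * B)
  linarith

theorem ar_mod (B q q' f f' : ℤ) (h0 : 0 ≤ q) (h0' : 0 ≤ q') (h1 : q < B) (h1' : q' < B)
    (h : q + B * f = q' + B * f') : q = q' := by
  have e1 : (q + B * f) % B = q := by
    rw [Int.add_mul_emod_self_left, Int.emod_eq_of_lt h0 h1]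
  have e2 : (q' + B * f') % B = q' := by
    rw [Int.add_mul_emod_self_left, Int.emod_eq_of_lt h0' h1']
  rw [← e1, ← e2, h]

theorem ar_bad (W B m k u v q q' : ℤ) (hP : 0 < W * B) (hW : W = m + k) (hm : 0 ≤ m)
    (h0 : 0 ≤ q) (h0' : 0 ≤ q') (h1 : q < B - 1) (h1' : q' < B - 1)
    (h : (u - W * (q + 1)) % (W * B) < k) (h' : (v - W * (q' + 1)) % (W * B) < k)
    (huv : |u - v| < m) : q = q' := by
  obtain ⟨f, r, hr, hr2, rfl⟩ := ar_rep W B k u q hP h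
  obtain ⟨f', r', hr', hr2', rfl⟩ := ar_rep W B k v q' hP h'
  have := ar_core W m k _ _ r r' hW hm hr hr' hr2 hr2' huv
  exact ar_mod B q q' f f' h0 h0' (by linarith) (by linarith) (by linarith)

theorem ar_bad0 (W B m k u q : ℤ) (hP : 0 < W * B) (hW : W = m + k) (hm : 0 ≤ m) (hk : 0 < k)
    (h0 : 0 ≤ q) (h1 : q < B - 1) (h : (u - W * (q + 1)) % (W * B) < k)
    (huv : |u| < m) : False := by
  obtain ⟨f, r, hr, hr2, rfl⟩ := ar_rep W B k u q hP h
  have := ar_core W m k (q + 1 + B * f) 0 r 0 hW hm hr le_rfl hr2 hk (by simpa using huv)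
  have := ar_mod B (q + 1) 0 f 0 (by linarith) le_rfl (by linarith) (by linarith) (by linarith)
  linarith

section Construction

/-- Number of middle coordinates. -/
def cM (k m : ℕ) : ℕ := 2 * k * (k + 1) + m + 1
/-- Side length in the middle coordinates. -/
def cN (k m : ℕ) : ℤ := ((2 * k + cM k m).factorial : ℤ)
def cB (k m : ℕ) : ℤ := (Fintype.card (Fin (cM k m) → ZMod 2) : ℤ) + 1
def cW (k m : ℕ) : ℤ := (m : ℤ) + k
def cP (k m : ℕ) : ℤ := cW k m * cB k m
def pa (k : ℕ) (x : ShPt) : ℤ := k * (x.base / k)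
def mid (k m : ℕ) (x : ShPt) (s : Fin (cM k m)) : ℤ :=
  x.coords (pa k x + 2 * k + (s : ℕ)) / cN k m
def pq (k m : ℕ) (x : ShPt) : ℤ :=
  ((Fintype.equivFin (Fin (cM k m) → ZMod 2) (fun s => (mid k m x s : ZMod 2)) : ℕ) : ℤ)
def shf (k m : ℕ) (x : ShPt) (t : Fin (2 * k)) : ℤ :=
  x.coords (pa k x + (t : ℕ)) - cW k m * (pq k m x + 1)
def isBad (k m : ℕ) (x : ShPt) (t : Fin (2 * k)) : Prop := shf k m x t % cP k m < k

def goodS (k m : ℕ) (e : ZMod 2) : Set ShPt :=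
  {x | ((x.base / k : ℤ) : ZMod 2) = e ∧ ∀ t, ¬ isBad k m x t}
def badS (k m : ℕ) (p : Fin (2 * k) × (Fin (2 * k) → ZMod 2) × ZMod (2 * k)) : Set ShPt :=
  {x | isBad k m x p.1 ∧ (∀ t : Fin (2 * k), ((x.coords (pa k x + (t : ℕ)) / m : ℤ) : ZMod 2) = p.2.1 t)
    ∧ (x.base : ZMod (2 * k)) = p.2.2}

theorem cN_pos (k m : ℕ) : 0 < cN k m := by
  unfold cN; exact_mod_cast Nat.factorial_pos _

theorem m_le_cN (k m : ℕ) : (m : ℤ) ≤ cN k m := by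
  unfold cN
  have := Nat.self_le_factorial (2 * k + cM k m)
  have h2 : m ≤ 2 * k + cM k m := by unfold cM; omega
  exact_mod_cast h2.trans this

theorem dvd_cN (k m : ℕ) (e : ℤ) (h1 : 1 ≤ e) (h2 : e ≤ 2 * k + cM k m) : e ∣ cN k m := by
  lift e to ℕ using by omega
  unfold cN
  exact_mod_cast Nat.dvd_factorial (by omega) (by omega)

theorem pq_nonneg (k m : ℕ) (x : ShPt) : 0 ≤ pq k m x := by unfold pq; positivity

theorem pq_lt (k m : ℕ) (x : ShPt) : pq k m x < cB k m - 1 := by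
  unfold pq cB
  have := (Fintype.equivFin (Fin (cM k m) → ZMod 2) (fun s => (mid k m x s : ZMod 2))).2
  rw [add_sub_cancel_right]
  exact_mod_cast this

theorem cP_pos (k m : ℕ) (hk : 1 ≤ k) : 0 < cP k m := by
  unfold cP cW cB; positivity

theorem pa_le (k : ℕ) (hk : 1 ≤ k) (x : ShPt) : pa k x ≤ x.base ∧ x.base < pa k x + k := by
  have hk' : (0 : ℤ) < k := by exact_mod_cast hk
  have h1 := Int.mul_ediv_add_emod x.base k
  have h2 := Int.emod_nonneg x.base hk'.ne'
  have h3 := Int.emod_lt_of_pos x.base hk'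
  unfold pa
  constructor <;> linarith

theorem pq_eq_mid (k m : ℕ) (x y : ShPt) (h : pq k m x = pq k m y) :
    ∀ s, (mid k m x s : ZMod 2) = (mid k m y s : ZMod 2) := by
  unfold pq at h
  have h1 : (fun s => (mid k m x s : ZMod 2)) = (fun s => (mid k m y s : ZMod 2)) := by
    apply (Fintype.equivFin (Fin (cM k m) → ZMod 2)).injective
    apply Fin.ext
    exact_mod_cast h
  exact fun s => congrFun h1 s

theorem mid_eq_pq (k m : ℕ) (x y : ShPt) (h : mid k m x = mid k m y) : pq k m x = pq k m y := by
  unfold pq; rw [h]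

theorem good_step (k m : ℕ) (hk : 1 ≤ k) (e : ZMod 2) (x y : ShPt)
    (h : Stp (goodS k m e) k x y) :
    x.base / k = y.base / k ∧ mid k m x = mid k m y ∧
      ∀ t, shf k m x t / cP k m = shf k m y t / cP k m := by
  obtain ⟨⟨hx, hx2⟩, ⟨hy, hy2⟩, hd⟩ := h
  have hk' : (0 : ℤ) < k := by exact_mod_cast hk
  have hb : x.base / k = y.base / k := by
    apply ar_par _ _ _ (hx.trans hy.symm)
    exact ar_adj k _ _ k hk' le_rfl (lt_of_le_of_lt (ShPt.base_le x y) hd)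
  have hpa : pa k x = pa k y := by unfold pa; rw [hb]
  have hxa := pa_le k hk x
  have hya := pa_le k hk y
  have hm : mid k m x = mid k m y := by
    funext s
    unfold mid
    rw [← hpa]
    rw [← hpa] at hya
    have hs : ((s : ℕ) : ℤ) < cM k m := by exact_mod_cast s.2
    set i := pa k x + 2 * k + ((s : ℕ) : ℤ) with hi
    have hs0 : (0 : ℤ) ≤ ((s : ℕ) : ℤ) := by positivity
    apply ar_wall (cN k m) _ _ (i - x.base + 1) (i - y.base + 1) k (cN_pos k m)
      (x.coords_dvd i (by omega)) (y.coords_dvd i (by omega))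
      (dvd_cN k m _ (by omega) (by omega)) (dvd_cN k m _ (by omega) (by omega))
      (by omega) (by omega) (lt_of_le_of_lt (ShPt.coord_le x y i) hd)
  refine ⟨hb, hm, fun t => ?_⟩
  apply ar_gap _ _ _ k (cP_pos k m hk) (hx2 t) (hy2 t)
  unfold shf
  rw [hpa, mid_eq_pq k m x y hm, sub_sub_sub_cancel_right]
  exact lt_of_le_of_lt (ShPt.coord_le x y _) hd

theorem good_chain (k m : ℕ) (hk : 1 ≤ k) (e : ZMod 2) (x y : ShPt)
    (h : Relation.ReflTransGen (Stp (goodS k m e) k) x y) :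
    x.base / k = y.base / k ∧ mid k m x = mid k m y ∧
      ∀ t, shf k m x t / cP k m = shf k m y t / cP k m := by
  induction h with
  | refl => exact ⟨rfl, rfl, fun _ => rfl⟩
  | tail _ h ih =>
    obtain ⟨a, b, c⟩ := good_step k m hk e _ _ h
    exact ⟨ih.1.trans a, ih.2.1.trans b, fun t => (ih.2.2 t).trans (c t)⟩

theorem good_far (k m : ℕ) (hk : 1 ≤ k) (e : ZMod 2) (x y : ShPt) (A : ℤ)
    (hA : A = pa k x + ((2 * k + cM k m : ℕ) : ℤ))
    (h : Relation.ReflTransGen (Stp (goodS k m e) k) x y) :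
    ShPt.dz (x.trunc A) (y.trunc A) ≤ k * k := by
  have hk' : (0 : ℤ) < k := by exact_mod_cast hk
  obtain ⟨s, hs1, hs2, hs⟩ := annulus k k hk
    {u | ∃ v : ShPt, u = v.trunc A ∧ v.base / k = x.base / k} (fun u => (u.base % k).toNat)
    (fun u => by
      have h2 := Int.emod_nonneg u.base hk'.ne'
      have h3 := Int.emod_lt_of_pos u.base hk'
      omega)
    (by
      rintro _ ⟨u, rfl, hu⟩ _ ⟨v, rfl, hv⟩ hc hd
      have hb : u.base = v.base := by
        have h2 := Int.emod_nonneg u.base hk'.ne'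
        have h3 := Int.emod_nonneg v.base hk'.ne'
        have h4 := Int.mul_ediv_add_emod u.base k
        have h5 := Int.mul_ediv_add_emod v.base k
        have hc' : (u.base % k).toNat = (v.base % k).toNat := hc
        have h6 : u.base % k = v.base % k := by omega
        rw [hu, h6] at h4
        rw [hv] at h5
        linarith
      have hua := pa_le k hk u
      have : pa k u = pa k x := by unfold pa; rw [hu]
      refine ShPt.trunc_eq A (cM k m) (by positivity) u v hb ?_ ?_
      · push_cast at hA
        linarith
      · refine hd.trans ?_
        unfold cM
        push_cast
        nlinarith)
    (x.trunc A) ⟨x, rfl, rfl⟩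
  have key : ShPt.dz (x.trunc A) (y.trunc A) < s * k := by
    induction h with
    | refl =>
      rw [ShPt.dz_self]; positivity
    | @tail b c hab hbc ih =>
      have hxc := (good_chain k m hk e x c (hab.tail hbc)).1
      have h1 := hs (c.trunc A) ⟨c, rfl, hxc.symm⟩
      have h2 := ShPt.dz_tri (x.trunc A) (b.trunc A) (c.trunc A)
      have h3 := ShPt.trunc_le A b c
      have h4 := hbc.2.2
      by_contra h5
      apply h1
      refine ⟨not_lt.mp h5, ?_⟩
      have : ((s : ℤ) + 1) * k = s * k + k := by ring
      rw [this]
      linarith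
  have : (s : ℤ) * k ≤ k * k := mul_le_mul_of_nonneg_right (by exact_mod_cast hs2) hk'.le
  linarith

theorem good_bdd (k m : ℕ) (hk : 1 ≤ k) (e : ZMod 2) : UniformlyBounded (Comps (goodS k m e) k) := by
  apply comps_bdd _ _ (k * k + ((2 * k + cM k m : ℕ) : ℤ) * (cP k m + cN k m))
  intro x _ y h
  have hfar := good_far k m hk e x y _ rfl h
  obtain ⟨hb, hm, hs⟩ := good_chain k m hk e x y h
  have hpa : pa k x = pa k y := by unfold pa; rw [hb]
  have hxa := pa_le k hk x
  have hya := pa_le k hk y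
  have := cP_pos k m hk
  have := cN_pos k m
  have := ShPt.le_trunc (pa k x) (2 * k + cM k m) (cP k m + cN k m) x y
    (fun i hi => x.coords_eq_zero i (by linarith)) (fun i hi => y.coords_eq_zero i (by linarith))
    (by
      intro i h1 h2
      push_cast at h2
      by_cases hi : i < pa k x + 2 * k
      · obtain ⟨t, rfl⟩ : ∃ t : ℕ, i = pa k x + t := ⟨(i - pa k x).toNat, by omega⟩
        have h3 := ar_same _ _ _ (cP_pos k m hk) (hs ⟨t, by omega⟩)
        unfold shf at h3
        rw [← hpa, mid_eq_pq k m x y hm, sub_sub_sub_cancel_right] at h3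
        simp only at h3
        linarith
      · obtain ⟨t, rfl⟩ : ∃ t : ℕ, i = pa k x + 2 * k + t :=
          ⟨(i - (pa k x + 2 * k)).toNat, by omega⟩
        have h3 := congrFun hm ⟨t, by omega⟩
        unfold mid at h3
        rw [← hpa] at h3
        have h4 := ar_same _ _ _ (cN_pos k m) h3
        simp only at h4
        linarith)
  linarith

theorem bad_base (k m : ℕ) (hk : 1 ≤ k) (p) (x y : ShPt)
    (h : Stp (badS k m p) m x y) : ¬ x.base < y.base := by
  intro hlt
  obtain ⟨⟨hx1, hx2, hx3⟩, ⟨hy1, hy2, hy3⟩, hd⟩ := h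
  have h1 : (x.base : ZMod (2 * k)) = y.base := hx3.trans hy3.symm
  rw [ZMod.intCast_eq_intCast_iff_dvd_sub] at h1
  have h2 := Int.le_of_dvd (by linarith) h1
  push_cast at h2
  have hxa := pa_le k hk x
  have ht : ((p.1 : ℕ) : ℤ) < 2 * k := by exact_mod_cast p.1.2
  have hy0 := y.coords_eq_zero (pa k x + (p.1 : ℕ)) (by linarith)
  have h3 := ShPt.coord_le x y (pa k x + (p.1 : ℕ))
  rw [hy0, sub_zero] at h3
  exact ar_bad0 (cW k m) (cB k m) m k _ (pq k m x) (cP_pos k m hk) rfl (by positivity)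
    (by exact_mod_cast hk) (pq_nonneg k m x) (pq_lt k m x) hx1 (lt_of_le_of_lt h3 hd)

theorem bad_step (k m : ℕ) (hk : 1 ≤ k) (hm : 1 ≤ m) (p) (x y : ShPt)
    (h : Stp (badS k m p) m x y) : x.base = y.base ∧ mid k m x = mid k m y ∧
      (∀ t : Fin (2 * k), x.coords (pa k x + (t : ℕ)) / m = y.coords (pa k y + (t : ℕ)) / m) ∧
      ShPt.dz (x.trunc (pa k x + ((2 * k + cM k m : ℕ) : ℤ)))
        (y.trunc (pa k x + ((2 * k + cM k m : ℕ) : ℤ))) = 0 := by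
  have hb : x.base = y.base :=
    le_antisymm (not_lt.mp (bad_base k m hk p y x (stp_symm _ _ _ _ h)))
      (not_lt.mp (bad_base k m hk p x y h))
  obtain ⟨⟨hx1, hx2, hx3⟩, ⟨hy1, hy2, hy3⟩, hd⟩ := h
  have hpa : pa k x = pa k y := by unfold pa; rw [hb]
  have hm' : (0 : ℤ) < m := by exact_mod_cast hm
  refine ⟨hb, ?_, ?_, ?_⟩
  · have hq : pq k m x = pq k m y := by
      refine ar_bad (cW k m) (cB k m) m k _ _ (pq k m x) (pq k m y) (cP_pos k m hk) rfl
        (by positivity) (pq_nonneg k m x) (pq_nonneg k m y) (pq_lt k m x) (pq_lt k m y) hx1 hy1 ?_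
      rw [← hpa]
      exact lt_of_le_of_lt (ShPt.coord_le x y _) hd
    funext s
    apply ar_par _ _ _ (pq_eq_mid k m x y hq s)
    unfold mid
    rw [← hpa]
    exact ar_adj _ _ _ m (cN_pos k m) (m_le_cN k m) (lt_of_le_of_lt (ShPt.coord_le x y _) hd)
  · intro t
    apply ar_par _ _ _ ((hx2 t).trans (hy2 t).symm)
    rw [← hpa]
    exact ar_adj _ _ _ m hm' le_rfl (lt_of_le_of_lt (ShPt.coord_le x y _) hd)
  · have hxa := pa_le k hk x
    refine ShPt.trunc_eq _ (cM k m) (by positivity) x y hb ?_ ?_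
    · push_cast
      linarith
    · refine (ShPt.trunc_le _ x y).trans (hd.le.trans ?_)
      unfold cM
      push_cast
      nlinarith

theorem bad_chain (k m : ℕ) (hk : 1 ≤ k) (hm : 1 ≤ m) (p) (x y : ShPt)
    (h : Relation.ReflTransGen (Stp (badS k m p) m) x y) : x.base = y.base ∧ mid k m x = mid k m y ∧
      (∀ t : Fin (2 * k), x.coords (pa k x + (t : ℕ)) / m = y.coords (pa k y + (t : ℕ)) / m) ∧
      ShPt.dz (x.trunc (pa k x + ((2 * k + cM k m : ℕ) : ℤ)))
        (y.trunc (pa k x + ((2 * k + cM k m : ℕ) : ℤ))) = 0 := by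
  induction h with
  | refl => exact ⟨rfl, rfl, fun _ => rfl, ShPt.dz_self _⟩
  | @tail b c _ h ih =>
    obtain ⟨h1, h2, h3, h4⟩ := bad_step k m hk hm p _ _ h
    obtain ⟨i1, i2, i3, i4⟩ := ih
    refine ⟨i1.trans h1, i2.trans h2, fun t => (i3 t).trans (h3 t), ?_⟩
    have hpa : pa k x = pa k b := by unfold pa; rw [i1]
    rw [← hpa] at h4
    have := ShPt.dz_tri (x.trunc (pa k x + ((2 * k + cM k m : ℕ) : ℤ)))
      (b.trunc (pa k x + ((2 * k + cM k m : ℕ) : ℤ))) (c.trunc (pa k x + ((2 * k + cM k m : ℕ) : ℤ)))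
    rw [h4, i4] at this
    exact le_antisymm (by simpa using this) (ShPt.dz_nonneg _ _)

theorem bad_bdd (k m : ℕ) (hk : 1 ≤ k) (hm : 1 ≤ m) (p) : UniformlyBounded (Comps (badS k m p) m) := by
  apply comps_bdd _ _ (((2 * k + cM k m : ℕ) : ℤ) * (m + cN k m))
  intro x _ y h
  obtain ⟨hb, hmid, hs, hfar⟩ := bad_chain k m hk hm p x y h
  have hpa : pa k x = pa k y := by unfold pa; rw [hb]
  have hxa := pa_le k hk x
  have hya := pa_le k hk y
  have hm' : (0 : ℤ) < m := by exact_mod_cast hm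
  have := cN_pos k m
  have := ShPt.le_trunc (pa k x) (2 * k + cM k m) (m + cN k m) x y
    (fun i hi => x.coords_eq_zero i (by linarith)) (fun i hi => y.coords_eq_zero i (by linarith))
    (by
      intro i h1 h2
      push_cast at h2
      by_cases hi : i < pa k x + 2 * k
      · obtain ⟨t, rfl⟩ : ∃ t : ℕ, i = pa k x + t := ⟨(i - pa k x).toNat, by omega⟩
        have h3 := hs ⟨t, by omega⟩
        rw [← hpa] at h3
        have h3 := ar_same _ _ _ hm' h3
        simp only at h3
        linarith
      · obtain ⟨t, rfl⟩ : ∃ t : ℕ, i = pa k x + 2 * k + t :=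
          ⟨(i - (pa k x + 2 * k)).toNat, by omega⟩
        have h3 := congrFun hmid ⟨t, by omega⟩
        unfold mid at h3
        rw [← hpa] at h3
        have h4 := ar_same _ _ _ (cN_pos k m) h3
        simp only at h4
        linarith)
  linarith

theorem cover_all (k m : ℕ) (x : ShPt) :
    x ∈ goodS k m 0 ∨ x ∈ goodS k m 1 ∨ ∃ p, x ∈ badS k m p := by
  by_cases h : ∀ t, ¬ isBad k m x t
  · have : ∀ z : ZMod 2, z = 0 ∨ z = 1 := by decide
    rcases this ((x.base / k : ℤ) : ZMod 2) with h1 | h1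
    · exact Or.inl ⟨h1, h⟩
    · exact Or.inr (Or.inl ⟨h1, h⟩)
  · push Not at h
    obtain ⟨t, ht⟩ := h
    exact Or.inr (Or.inr ⟨⟨t, _, _⟩, ht, fun _ => rfl, rfl⟩)

end Construction

/-- Proposition 5.1: the shift union `sh⋃ ⊕_{i=1}^∞ iℤ` has `trasdim ≤ ω + 1`. -/
theorem trasdim_shift_union_le : OrdLE (Ordinal.omega0 + 1) (AColl ShPt) := by
  rw [OrdLE]
  right
  intro a
  refine ⟨⟨Ordinal.omega0, by simp⟩, ?_⟩
  show OrdLE Ordinal.omega0 _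
  rw [OrdLE]
  right
  intro b
  obtain ⟨k, hk⟩ : ∃ k, k = max a b + 1 := ⟨_, rfl⟩
  have hk1 : 1 ≤ k := by omega
  haveI : NeZero (2 * k) := ⟨by omega⟩
  refine ⟨⟨(Fintype.card (Fin (2 * k) × (Fin (2 * k) → ZMod 2) × ZMod (2 * k)) : ℕ),
    Ordinal.natCast_lt_omega0 _⟩, ?_⟩
  apply ordLE_nat
  rintro τ ⟨⟨⟨_, hno⟩, ha⟩, hb⟩
  by_contra hcard
  apply hno
  have hab : b ≠ a := fun h => ha (by simp [h])
  have haτ : a ∉ τ := fun h => ha (by simp [h])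
  obtain ⟨m, hm⟩ : ∃ m, m = τ.sup id + 1 := ⟨_, rfl⟩
  have hm1 : 1 ≤ m := by omega
  rw [not_lt, ← Fintype.card_coe τ] at hcard
  obtain ⟨f⟩ := Function.Embedding.nonempty_of_card_le hcard
  haveI : Nonempty (Fin (2 * k) × (Fin (2 * k) → ZMod 2) × ZMod (2 * k)) := inferInstance
  let F : (Fin (2 * k) × (Fin (2 * k) → ZMod 2) × ZMod (2 * k)) → ℕ := fun p => (f p : ℕ)
  have hF : Function.Injective F := fun p q h => f.injective (Subtype.ext h)
  refine ⟨fun n => if n = a then Comps (goodS k m 0) k else if n = b then Comps (goodS k m 1) k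
    else Comps (badS k m (Function.invFun F n)) m, ?_, ?_, ?_⟩
  · intro i _
    dsimp only
    split_ifs
    · exact good_bdd k m hk1 0
    · exact good_bdd k m hk1 1
    · exact bad_bdd k m hk1 hm1 _
  · intro i hi
    dsimp only
    split_ifs with h1 h2
    · apply comps_disj
      have : i ≤ k := by omega
      exact_mod_cast this
    · apply comps_disj
      have : i ≤ k := by omega
      exact_mod_cast this
    · apply comps_disj
      have hiτ : i ∈ τ := by
        simp only [Finset.mem_insert] at hi
        tauto
      have : i ≤ τ.sup id := Finset.le_sup (f := id) hiτ
      have : i ≤ m := by omega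
      exact_mod_cast this
  · intro x _
    simp only [Set.mem_iUnion]
    rcases cover_all k m x with h | h | ⟨p, h⟩
    · refine ⟨a, by simp, ?_⟩
      rw [if_pos rfl]
      exact comps_cover _ _ h
    · refine ⟨b, by simp, ?_⟩
      rw [if_neg hab, if_pos rfl]
      exact comps_cover _ _ h
    · have hp : F p ∈ τ := (f p).2
      refine ⟨F p, by simp [hp], ?_⟩
      have n1 : F p ≠ a := fun h => haτ (h ▸ hp)
      have n2 : F p ≠ b := fun h => hb (h ▸ hp)
      rw [if_neg n1, if_neg n2,
        Function.leftInverse_invFun hF p]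
      exact comps_cover _ _ h
end
end
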